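/- (Generating function.) Let ν, μ ∈ ℂ, x ∈ (-1,1), and s ∈ ℝ with |s| < 1 - |x|. Then ∑_{n=0}^∞ (P_ν^{n-μ}(x) / (1-x²)^{(n-μ)/2}) · s^n / n! = P_ν^{-μ}(x - s) · (1 - (x-s)²)^{μ/2}, the series converging; note that x - s ∈ (-1,1) under these hypotheses. -/

import Mathlib

noncomputable def pochC (a : ℂ) (n : ℕ) : ℂ := (ascPochhammer ℂ n).eval a

/-- Ferrers function of the first kind `P_ν^μ(x)`. -/
noncomputable def ferrersP (ν μ : ℂ) (x : ℝ) : ℂ :=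
  (((1 + x) / (1 - x) : ℝ) : ℂ) ^ (μ / 2) *
    ∑' n : ℕ, pochC (-ν) n * pochC (ν + 1) n /
        (Complex.Gamma ((n : ℂ) + 1 - μ) * (n.factorial : ℂ)) *
      (((1 - x) / 2 : ℝ) : ℂ) ^ n

open Complex Filter Topology

/-- Coefficients of the regularized hypergeometric series in `ferrersP ν (-μ)`. -/
noncomputable def ferrersCoeff (ν μ : ℂ) (n : ℕ) : ℂ :=
  pochC (-ν) n * pochC (ν + 1) n / (Complex.Gamma ((n : ℂ) + 1 + μ) * (n.factorial : ℂ))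

/-- The regularized hypergeometric series in `ferrersP ν (-μ)`. -/
noncomputable def ferrersSeries (ν μ t : ℂ) : ℂ := ∑' n : ℕ, ferrersCoeff ν μ n * t ^ n

/-- The holomorphic function `w ^ μ * F(w / 2)` whose Taylor series is the generating function. -/
noncomputable def ferrersAux (ν μ w : ℂ) : ℂ := w ^ μ * ferrersSeries ν μ (w / 2)

lemma pochC_succ (a : ℂ) (n : ℕ) : pochC a (n + 1) = pochC a n * (a + n) := by
  simp [pochC, ascPochhammer_succ_eval]

lemma ferrersCoeff_sub_one (ν μ : ℂ) (n : ℕ) :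
    ferrersCoeff ν (μ - 1) n = (n + μ) * ferrersCoeff ν μ n := by
  have h := Complex.one_div_Gamma_eq_self_mul_one_div_Gamma_add_one ((n : ℂ) + μ)
  have h1 : (n : ℂ) + 1 + (μ - 1) = n + μ := by ring
  have h2 : (n : ℂ) + 1 + μ = n + μ + 1 := by ring
  simp only [ferrersCoeff, div_eq_mul_inv, mul_inv, h1, h2]
  rw [h]
  ring

lemma ferrersCoeff_succ (ν μ : ℂ) (n : ℕ) :
    (n + 1 + μ) * (n + 1) * ferrersCoeff ν μ (n + 1)
      = (n - ν) * (n + ν + 1) * ferrersCoeff ν μ n := by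
  have h := Complex.one_div_Gamma_eq_self_mul_one_div_Gamma_add_one ((n : ℂ) + 1 + μ)
  have h1 : ((n + 1 : ℕ) : ℂ) + 1 + μ = n + 1 + μ + 1 := by push_cast; ring
  have h3 : (n : ℂ) + 1 ≠ 0 := Nat.cast_add_one_ne_zero n
  simp only [ferrersCoeff, div_eq_mul_inv, mul_inv, h1, pochC_succ, Nat.factorial_succ]
  rw [h]
  push_cast
  field_simp
  ring

lemma tendsto_norm_natCast_add_div (a : ℂ) :
    Tendsto (fun n : ℕ => ‖(n : ℂ) + a‖ / n) atTop (𝓝 1) := by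
  have h : Tendsto (fun n : ℕ => ‖1 + a / (n : ℂ)‖) atTop (𝓝 ‖1 + (0 : ℂ)‖) :=
    ((tendsto_const_div_atTop_nhds_zero_nat a).const_add 1).norm
  rw [add_zero, norm_one] at h
  refine h.congr' ?_
  filter_upwards [eventually_gt_atTop 0] with n hn
  have hn' : (n : ℂ) ≠ 0 := by exact_mod_cast hn.ne'
  rw [show 1 + a / (n : ℂ) = (n + a) / n by field_simp, norm_div, norm_natCast]

lemma summable_ferrersCoeff_mul_pow (ν μ : ℂ) {r : ℝ} (h0 : 0 ≤ r) (h1 : r < 1) :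
    Summable fun n : ℕ => ‖ferrersCoeff ν μ n‖ * r ^ n := by
  obtain ⟨q, hq, hq1⟩ := exists_between h1
  have hlim : Tendsto (fun n : ℕ => (‖(n : ℂ) + -ν‖ / n * (‖(n : ℂ) + (ν + 1)‖ / n)) /
      (‖(n : ℂ) + (1 + μ)‖ / n * (‖(n : ℂ) + 1‖ / n)) * r) atTop (𝓝 ((1 * 1) / (1 * 1) * r)) :=
    (((tendsto_norm_natCast_add_div _).mul (tendsto_norm_natCast_add_div _)).div
      ((tendsto_norm_natCast_add_div _).mul (tendsto_norm_natCast_add_div _))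
      (by norm_num)).mul_const r
  have hpos := (tendsto_norm_natCast_add_div (1 + μ)).eventually_ne one_ne_zero
  refine summable_of_ratio_norm_eventually_le hq1 ?_
  filter_upwards [hlim.eventually_le_const (by simpa using hq), hpos, eventually_gt_atTop 0]
    with n hn hne hn0
  have hn' : (0 : ℝ) < n := by exact_mod_cast hn0
  have hA : 0 < ‖(n : ℂ) + (1 + μ)‖ :=
    lt_of_le_of_ne (norm_nonneg _) fun h => hne (by rw [← h, zero_div])
  have hB : 0 < ‖(n : ℂ) + 1‖ := norm_pos_iff.2 (Nat.cast_add_one_ne_zero n)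
  have hrec := congrArg norm (ferrersCoeff_succ ν μ n)
  simp only [norm_mul] at hrec
  rw [show (n : ℂ) + 1 + μ = n + (1 + μ) by ring, show (n : ℂ) - ν = n + -ν by ring,
    show (n : ℂ) + ν + 1 = n + (ν + 1) by ring] at hrec
  simp only [norm_mul, norm_norm, norm_pow, Real.norm_of_nonneg h0]
  have hc : ‖ferrersCoeff ν μ (n + 1)‖ = (‖(n : ℂ) + -ν‖ / n * (‖(n : ℂ) + (ν + 1)‖ / n)) /
      (‖(n : ℂ) + (1 + μ)‖ / n * (‖(n : ℂ) + 1‖ / n)) * ‖ferrersCoeff ν μ n‖ := by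
    field_simp
    linarith
  refine le_of_eq_of_le ?_ (mul_le_mul_of_nonneg_right hn (by positivity))
  rw [hc, pow_succ', mul_mul_mul_comm]

lemma summable_ferrersSeries (ν μ : ℂ) {t : ℂ} (ht : ‖t‖ < 1) :
    Summable fun n : ℕ => ferrersCoeff ν μ n * t ^ n :=
  .of_norm <| by
    simpa only [norm_mul, norm_pow] using summable_ferrersCoeff_mul_pow ν μ (norm_nonneg t) ht

lemma hasDerivAt_ferrersSeries (ν μ : ℂ) {t : ℂ} (ht : ‖t‖ < 1) :
    ∃ d, HasDerivAt (ferrersSeries ν μ) d t ∧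
      μ * ferrersSeries ν μ t + t * d = ferrersSeries ν (μ - 1) t := by
  obtain ⟨r, hr, hr1⟩ := exists_between ht
  have hu := summable_ferrersCoeff_mul_pow ν μ ((norm_nonneg t).trans hr.le) hr1
  have hd : ∀ n : ℕ, DifferentiableOn ℂ (fun w : ℂ => ferrersCoeff ν μ n * w ^ n)
      (Metric.ball 0 r) := fun n => by fun_prop
  have hle : ∀ (n : ℕ) (w : ℂ), w ∈ Metric.ball (0 : ℂ) r →
      ‖ferrersCoeff ν μ n * w ^ n‖ ≤ ‖ferrersCoeff ν μ n‖ * r ^ n := fun n w hw => by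
    rw [mem_ball_zero_iff] at hw
    rw [norm_mul, norm_pow]
    gcongr
  have hmem : t ∈ Metric.ball (0 : ℂ) r := mem_ball_zero_iff.2 hr
  have hdiff := (Complex.differentiableOn_tsum_of_summable_norm hu hd Metric.isOpen_ball
    hle).differentiableAt (Metric.isOpen_ball.mem_nhds hmem)
  refine ⟨_, hdiff.hasDerivAt, ?_⟩
  have hs := ((summable_ferrersSeries ν μ ht).hasSum.mul_left μ).add
    ((Complex.hasSum_deriv_of_summable_norm hu hd Metric.isOpen_ball hle hmem).mul_left t)
  refine hs.tsum_eq.symm.trans (tsum_congr fun n => ?_)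
  rw [ferrersCoeff_sub_one]
  rcases n with _ | n
  · simp
  · simp only [deriv_const_mul_field, deriv_pow_field]
    push_cast
    ring

lemma hasDerivAt_ferrersAux (ν μ : ℂ) {w : ℂ} (hw : w ∈ slitPlane) (hw2 : ‖w‖ < 2) :
    HasDerivAt (ferrersAux ν μ) (ferrersAux ν (μ - 1) w) w := by
  have ht : ‖w / 2‖ < 1 := by
    rw [norm_div, Complex.norm_two]
    linarith
  obtain ⟨d, hd, he⟩ := hasDerivAt_ferrersSeries ν μ ht
  have h1 := (hasDerivAt_id w).cpow_const (c := μ) hw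
  have h2 := hd.comp w ((hasDerivAt_id w).div_const 2)
  refine (h1.mul h2).congr_deriv ?_
  have h0 : w ≠ 0 := slitPlane_ne_zero hw
  simp only [ferrersAux, ← he, id, Function.comp, cpow_sub _ _ h0, cpow_one]
  field_simp

lemma iteratedDeriv_ferrersAux (ν μ : ℂ) {U : Set ℂ} (hU : IsOpen U) (hs : U ⊆ slitPlane)
    (h2 : ∀ w ∈ U, ‖w‖ < 2) (n : ℕ) :
    ∀ w ∈ U, iteratedDeriv n (ferrersAux ν μ) w = ferrersAux ν (μ - n) w := by
  induction n with
  | zero => simp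
  | succ n ih =>
    intro w hw
    have he : iteratedDeriv n (ferrersAux ν μ) =ᶠ[𝓝 w] ferrersAux ν (μ - n) :=
      eventually_of_mem (hU.mem_nhds hw) ih
    rw [iteratedDeriv_succ, he.deriv_eq, (hasDerivAt_ferrersAux ν _ (hs hw) (h2 w hw)).deriv]
    congr 1
    push_cast
    ring

lemma ferrersP_neg_mul_cpow (ν μ : ℂ) {x : ℝ} (hx : -1 < x) (hx1 : x < 1) :
    ferrersP ν (-μ) x * ((1 - x ^ 2 : ℝ) : ℂ) ^ (μ / 2) = ferrersAux ν μ ((1 - x : ℝ) : ℂ) := by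
  have hu : 0 < 1 + x := by linarith
  have hv : 0 < 1 - x := by linarith
  have hp : (((1 + x) / (1 - x) : ℝ) : ℂ) ^ (-μ / 2) * ((1 - x ^ 2 : ℝ) : ℂ) ^ (μ / 2)
      = ((1 - x : ℝ) : ℂ) ^ μ := by
    rw [show 1 - x ^ 2 = (1 + x) * (1 - x) by ring,
      cpow_def_of_ne_zero (ofReal_ne_zero.2 (div_pos hu hv).ne'),
      cpow_def_of_ne_zero (ofReal_ne_zero.2 (mul_pos hu hv).ne'),
      cpow_def_of_ne_zero (ofReal_ne_zero.2 hv.ne'),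
      ← ofReal_log (div_pos hu hv).le, ← ofReal_log (mul_pos hu hv).le, ← ofReal_log hv.le,
      Real.log_div hu.ne' hv.ne', Real.log_mul hu.ne' hv.ne', ← Complex.exp_add]
    push_cast
    ring_nf
  rw [ferrersP, mul_right_comm, hp, ferrersAux, ferrersSeries]
  simp only [ferrersCoeff, sub_neg_eq_add, ofReal_div, ofReal_ofNat]

theorem stmt15 (ν μ : ℂ) (x s : ℝ) (hx : -1 < x) (hx1 : x < 1) (hs : |s| < 1 - |x|) :
    HasSum
      (fun n : ℕ => ferrersP ν ((n : ℂ) - μ) x / ((1 - x ^ 2 : ℝ) : ℂ) ^ (((n : ℂ) - μ) / 2) *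
        (s : ℂ) ^ n / (n.factorial : ℂ))
      (ferrersP ν (-μ) (x - s) * ((1 - (x - s) ^ 2 : ℝ) : ℂ) ^ (μ / 2)) := by
  have hxa := le_abs_self x
  have hxb := neg_abs_le x
  have hsa := le_abs_self s
  have hsb := neg_abs_le s
  have hdist : ∀ w ∈ Metric.ball ((1 - x : ℝ) : ℂ) (1 - |x|), ‖w - (1 - x : ℝ)‖ < 1 - |x| :=
    fun w hw => by rwa [← dist_eq_norm]
  have hslit : Metric.ball ((1 - x : ℝ) : ℂ) (1 - |x|) ⊆ slitPlane := fun w hw => by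
    have h := neg_abs_le (w - (1 - x : ℝ)).re
    have h' := (abs_re_le_norm (w - (1 - x : ℝ))).trans_lt (hdist w hw)
    rw [sub_re, ofReal_re] at h h'
    exact Or.inl (by linarith)
  have hnorm : ∀ w ∈ Metric.ball ((1 - x : ℝ) : ℂ) (1 - |x|), ‖w‖ < 2 := fun w hw => by
    have h := norm_le_norm_add_norm_sub' w ((1 - x : ℝ) : ℂ)
    rw [norm_real, Real.norm_of_nonneg (by linarith : 0 ≤ 1 - x)] at h
    linarith [hdist w hw]
  have hdiff : DifferentiableOn ℂ (ferrersAux ν μ) (Metric.ball ((1 - x : ℝ) : ℂ) (1 - |x|)) :=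
    fun w hw => (hasDerivAt_ferrersAux ν μ (hslit hw)
      (hnorm w hw)).differentiableAt.differentiableWithinAt
  have hsub : ((1 - (x - s) : ℝ) : ℂ) - (1 - x : ℝ) = s := by push_cast; ring
  have hmem : ((1 - (x - s) : ℝ) : ℂ) ∈ Metric.ball ((1 - x : ℝ) : ℂ) (1 - |x|) := by
    rwa [Metric.mem_ball, dist_eq_norm, hsub, norm_real, Real.norm_eq_abs]
  rw [ferrersP_neg_mul_cpow ν μ (by linarith) (by linarith)]
  refine Eq.subst (motive := fun f => HasSum f _) (funext fun n => ?_)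
    (Complex.hasSum_taylorSeries_on_ball hdiff hmem)
  rw [iteratedDeriv_ferrersAux ν μ Metric.isOpen_ball hslit hnorm n _
    (Metric.mem_ball_self (by linarith [abs_nonneg s])), hsub,
    ← ferrersP_neg_mul_cpow ν (μ - n) hx hx1, neg_sub,
    show (μ - n) / 2 = -((n - μ) / 2) by ring, cpow_neg, smul_eq_mul, smul_eq_mul]
  ring
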